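/- arXiv:2110.08923 — 3 statements merged into one kernel-verified Lean document; each statement's English description precedes it below -/
import Mathlib

section
/- For any two policies π₁ and π₂, |V^{π₁}(ρ) − V^{π₂}(ρ)| ≤ (√|A|/(1−γ)²)·‖π₁ − π₂‖₂, where ‖·‖₂ denotes the Euclidean norm of the difference of the policy vectors in ℝ^{|S||A|}. -/
open scoped BigOperators

section CMDP

variable {S A : Type} [Fintype S] [Fintype A]

/-- `P` is a transition kernel: each `P s a` is a probability distribution over states. -/
def IsKernel (P : S → A → S → ℝ) : Prop :=
  (∀ s a s', 0 ≤ P s a s') ∧ ∀ s a, ∑ s', P s a s' = 1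

/-- `ρ` is a probability distribution over states. -/
def IsDist (ρ : S → ℝ) : Prop := (∀ s, 0 ≤ ρ s) ∧ ∑ s, ρ s = 1

/-- `π` is a (stationary, stochastic) policy. -/
def IsPolicy (π : S → A → ℝ) : Prop := (∀ s a, 0 ≤ π s a) ∧ ∀ s, ∑ a, π s a = 1

/-- One step of the state-action distribution dynamics under kernel `P` and policy `π`. -/
noncomputable def stepDist (P : S → A → S → ℝ) (π : S → A → ℝ) (μ : S → A → ℝ) :
    S → A → ℝ :=
  fun s a => (∑ s', ∑ a', μ s' a' * P s' a' s) * π s a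

/-- State-action distribution at time `t` of the Markov chain induced by `π`,
with initial state-action distribution `μ₀`. -/
noncomputable def trajSA (P : S → A → S → ℝ) (π : S → A → ℝ) (μ₀ : S → A → ℝ) :
    ℕ → S → A → ℝ
  | 0 => μ₀
  | (t + 1) => stepDist P π (trajSA P π μ₀ t)

/-- Initial state-action distribution when `s₀ ∼ ρ`, `a₀ ∼ π(·|s₀)`. -/
noncomputable def initSA (ρ : S → ℝ) (π : S → A → ℝ) : S → A → ℝ := fun s a => ρ s * π s a

/-- Initial state-action distribution that is a Dirac at `(s₀, a₀)`. -/
noncomputable def diracSA [DecidableEq S] [DecidableEq A] (s₀ : S) (a₀ : A) : S → A → ℝ :=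
  fun s a => if s = s₀ ∧ a = a₀ then 1 else 0

/-- Expected discounted cumulative value `E[∑ γ^t c(s_t,a_t)]` with initial
state-action distribution `μ₀`. -/
noncomputable def dsum (γ : ℝ) (P : S → A → S → ℝ) (π : S → A → ℝ) (μ₀ : S → A → ℝ)
    (c : S → A → ℝ) : ℝ :=
  ∑' t : ℕ, γ ^ t * ∑ s, ∑ a, trajSA P π μ₀ t s a * c s a

/-- Value function `V^π(ρ)` (for reward/utility `c`). -/
noncomputable def Vval (γ : ℝ) (P : S → A → S → ℝ) (π : S → A → ℝ) (ρ : S → ℝ)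
    (c : S → A → ℝ) : ℝ := dsum γ P π (initSA ρ π) c

/-- Q-function `Q^π(s,a)` (for reward/utility `c`). -/
noncomputable def Qval [DecidableEq S] [DecidableEq A] (γ : ℝ) (P : S → A → S → ℝ)
    (π : S → A → ℝ) (s : S) (a : A) (c : S → A → ℝ) : ℝ :=
  dsum γ P π (diracSA s a) c

/-- Discounted state visitation distribution `d_ρ^π(s)`. -/
noncomputable def visit (γ : ℝ) (P : S → A → S → ℝ) (π : S → A → ℝ) (ρ : S → ℝ)
    (s : S) : ℝ :=
  (1 - γ) * ∑' t : ℕ, γ ^ t * ∑ a, trajSA P π (initSA ρ π) t s a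

/-- Discounted entropy `H(ρ, π)`. -/
noncomputable def Hent (γ : ℝ) (P : S → A → S → ℝ) (π : S → A → ℝ) (ρ : S → ℝ) : ℝ :=
  Vval γ P π ρ (fun s a => -Real.log (π s a))

/-- Entropy-regularized value function `V_τ^π(ρ)`. -/
noncomputable def Vtau (γ τ : ℝ) (P : S → A → S → ℝ) (π : S → A → ℝ) (ρ : S → ℝ)
    (c : S → A → ℝ) : ℝ := Vval γ P π ρ c + τ * Hent γ P π ρ

/-- Euclidean norm of a vector indexed by state-action pairs. -/
noncomputable def polNorm2 (x : S → A → ℝ) : ℝ := Real.sqrt (∑ s, ∑ a, (x s a) ^ 2)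

/-- Euclidean norm of a vector in `ℝ^n`. -/
noncomputable def vecNorm2 {n : ℕ} (x : Fin n → ℝ) : ℝ := Real.sqrt (∑ i, (x i) ^ 2)

/-- The soft-max policy associated with parameter `θ`. -/
noncomputable def softmaxPol (θ : S → A → ℝ) : S → A → ℝ :=
  fun s a => Real.exp (θ s a) / ∑ a', Real.exp (θ s a')

/-- Membership in the soft-max policy class `Π`. -/
def InSoftmax (π : S → A → ℝ) : Prop := ∃ θ : S → A → ℝ, π = softmaxPol θ

/-- Lagrangian `L(π, λ)` of the entropy-regularized CMDP. -/
noncomputable def Lag (γ τ : ℝ) (P : S → A → S → ℝ) (ρ : S → ℝ) (r : S → A → ℝ)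
    {n : ℕ} (g : Fin n → S → A → ℝ) (b : Fin n → ℝ) (π : S → A → ℝ)
    (lam : Fin n → ℝ) : ℝ :=
  Vtau γ τ P π ρ r + ∑ i, lam i * (Vval γ P π ρ (g i) - b i)

/-- Dual function `D(λ) = max_{π ∈ Π} L(π, λ)`. -/
noncomputable def Dual (γ τ : ℝ) (P : S → A → S → ℝ) (ρ : S → ℝ) (r : S → A → ℝ)
    {n : ℕ} (g : Fin n → S → A → ℝ) (b : Fin n → ℝ) (lam : Fin n → ℝ) : ℝ :=
  sSup ((fun π : S → A → ℝ => Lag γ τ P ρ r g b π lam) '' {π | InSoftmax π})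

end CMDP

section StateActionDistributions

variable {S A : Type} [Fintype S] [Fintype A]

/-- Distribution of the next state when the current state-action pair is distributed as `μ`. -/
noncomputable def nextState (P : S → A → S → ℝ) (μ : S → A → ℝ) : S → ℝ :=
  fun s => ∑ s', ∑ a', μ s' a' * P s' a' s

theorem IsKernel.sum_nextState {P : S → A → S → ℝ} (hP : IsKernel P) (μ : S → A → ℝ) :
    ∑ s, nextState P μ s = ∑ s, ∑ a, μ s a := by
  unfold nextState
  rw [Finset.sum_comm]
  refine Finset.sum_congr rfl fun s' _ => ?_
  rw [Finset.sum_comm]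
  refine Finset.sum_congr rfl fun a' _ => ?_
  rw [← Finset.mul_sum, hP.2, mul_one]

theorem IsPolicy.sum_initSA {π : S → A → ℝ} (hπ : IsPolicy π) (x : S → ℝ) :
    ∑ s, ∑ a, initSA x π s a = ∑ s, x s := by
  simp [initSA, ← Finset.mul_sum, hπ.2]

theorem trajSA_succ_eq_initSA (P : S → A → S → ℝ) (π μ : S → A → ℝ) (t : ℕ) :
    trajSA P π μ (t + 1) = initSA (nextState P (trajSA P π μ t)) π := rfl

/-- A state-action distribution generated by a policy stays a probability distribution. -/
theorem trajSA_isProb {P : S → A → S → ℝ} (hP : IsKernel P) {π : S → A → ℝ} (hπ : IsPolicy π)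
    {ρ : S → ℝ} (hρ : IsDist ρ) (t : ℕ) :
    (∀ s a, 0 ≤ trajSA P π (initSA ρ π) t s a) ∧
      ∑ s, ∑ a, trajSA P π (initSA ρ π) t s a = 1 := by
  induction t with
  | zero =>
    exact ⟨fun s a => mul_nonneg (hρ.1 s) (hπ.1 s a), (hπ.sum_initSA ρ).trans hρ.2⟩
  | succ t ih =>
    rw [trajSA_succ_eq_initSA]
    refine ⟨fun s a => mul_nonneg (Finset.sum_nonneg fun s' _ => Finset.sum_nonneg fun a' _ =>
      mul_nonneg (ih.1 s' a') (hP.1 s' a' s)) (hπ.1 s a), ?_⟩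
    rw [hπ.sum_initSA, hP.sum_nextState, ih.2]

/-- The state marginals are probability distributions. -/
theorem nextState_isDist {P : S → A → S → ℝ} (hP : IsKernel P) {μ : S → A → ℝ}
    (hμ : (∀ s a, 0 ≤ μ s a) ∧ ∑ s, ∑ a, μ s a = 1) : IsDist (nextState P μ) :=
  ⟨fun s => Finset.sum_nonneg fun s' _ => Finset.sum_nonneg fun a' _ =>
    mul_nonneg (hμ.1 s' a') (hP.1 s' a' s), (hP.sum_nextState μ).trans hμ.2⟩

/-- Passing to the next state does not increase the `ℓ¹` distance. -/
theorem sum_abs_nextState_sub_le {P : S → A → S → ℝ} (hP : IsKernel P) (μ ν : S → A → ℝ) :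
    ∑ s, |nextState P μ s - nextState P ν s| ≤ ∑ s, ∑ a, |μ s a - ν s a| := by
  rw [← hP.sum_nextState]
  refine Finset.sum_le_sum fun s _ => ?_
  simp only [nextState, ← Finset.sum_sub_distrib, ← sub_mul]
  refine (Finset.abs_sum_le_sum_abs _ _).trans (Finset.sum_le_sum fun s' _ => ?_)
  refine (Finset.abs_sum_le_sum_abs _ _).trans (Finset.sum_le_sum fun a' _ => ?_)
  rw [abs_mul, abs_of_nonneg (hP.1 s' a' s)]

theorem sum_abs_initSA_sub_le {x y : S → ℝ} (hx : IsDist x) {π₁ π₂ : S → A → ℝ}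
    (h₂ : IsPolicy π₂) {D : ℝ} (hD : ∀ s, ∑ a, |π₁ s a - π₂ s a| ≤ D) :
    ∑ s, ∑ a, |initSA x π₁ s a - initSA y π₂ s a| ≤ ∑ s, |x s - y s| + D := by
  have key (s : S) : ∑ a, |initSA x π₁ s a - initSA y π₂ s a| ≤ |x s - y s| + x s * D := by
    calc ∑ a, |initSA x π₁ s a - initSA y π₂ s a|
        ≤ ∑ a, (|x s - y s| * π₂ s a + x s * |π₁ s a - π₂ s a|) := by
          refine Finset.sum_le_sum fun a _ => ?_
          rw [← abs_of_nonneg (h₂.1 s a), ← abs_mul, abs_of_nonneg (h₂.1 s a)]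
          nth_rewrite 2 [← abs_of_nonneg (hx.1 s)]
          rw [← abs_mul]
          refine le_trans (le_of_eq ?_) (abs_add_le _ _)
          congr 1
          simp only [initSA]
          ring
      _ = |x s - y s| + x s * ∑ a, |π₁ s a - π₂ s a| := by
          rw [Finset.sum_add_distrib, ← Finset.mul_sum, ← Finset.mul_sum, h₂.2, mul_one]
      _ ≤ |x s - y s| + x s * D := by
          gcongr
          · exact hx.1 s
          · exact hD s
  refine (Finset.sum_le_sum fun s _ => key s).trans (le_of_eq ?_)
  rw [Finset.sum_add_distrib, ← Finset.sum_mul, hx.2, one_mul]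

/-- The `ℓ¹` distance of the state-action distributions of two policies grows at most linearly. -/
theorem sum_abs_trajSA_sub_le {P : S → A → S → ℝ} (hP : IsKernel P) {ρ : S → ℝ} (hρ : IsDist ρ)
    {π₁ π₂ : S → A → ℝ} (h₁ : IsPolicy π₁) (h₂ : IsPolicy π₂) {D : ℝ}
    (hD : ∀ s, ∑ a, |π₁ s a - π₂ s a| ≤ D) (t : ℕ) :
    ∑ s, ∑ a, |trajSA P π₁ (initSA ρ π₁) t s a - trajSA P π₂ (initSA ρ π₂) t s a|
      ≤ (t + 1) * D := by
  induction t with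
  | zero => simpa [trajSA] using sum_abs_initSA_sub_le (y := ρ) hρ h₂ hD
  | succ t ih =>
    simp only [trajSA_succ_eq_initSA]
    refine (sum_abs_initSA_sub_le
      (nextState_isDist hP (trajSA_isProb hP h₁ hρ t)) h₂ hD).trans ?_
    have := sum_abs_nextState_sub_le hP (trajSA P π₁ (initSA ρ π₁) t)
      (trajSA P π₂ (initSA ρ π₂) t)
    push_cast
    linarith

theorem abs_sum_mul_le_sum_abs {c : S → A → ℝ} (hc : ∀ s a, |c s a| ≤ 1) (μ : S → A → ℝ) :
    |∑ s, ∑ a, μ s a * c s a| ≤ ∑ s, ∑ a, |μ s a| := by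
  refine (Finset.abs_sum_le_sum_abs _ _).trans (Finset.sum_le_sum fun s _ => ?_)
  refine (Finset.abs_sum_le_sum_abs _ _).trans (Finset.sum_le_sum fun a _ => ?_)
  rw [abs_mul]
  exact mul_le_of_le_one_right (abs_nonneg _) (hc s a)

/-- The discounted series defining the value function converges. -/
theorem summable_discounted_trajSA {γ : ℝ} (hγ : γ ∈ Set.Ico (0 : ℝ) 1) {P : S → A → S → ℝ}
    (hP : IsKernel P) {π : S → A → ℝ} (hπ : IsPolicy π) {ρ : S → ℝ} (hρ : IsDist ρ)
    {c : S → A → ℝ} (hc : ∀ s a, |c s a| ≤ 1) :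
    Summable fun t : ℕ => γ ^ t * ∑ s, ∑ a, trajSA P π (initSA ρ π) t s a * c s a := by
  refine Summable.of_norm_bounded (summable_geometric_of_lt_one hγ.1 hγ.2) fun t => ?_
  obtain ⟨hnonneg, hsum⟩ := trajSA_isProb hP hπ hρ t
  rw [Real.norm_eq_abs, abs_mul, abs_of_nonneg (pow_nonneg hγ.1 t)]
  refine mul_le_of_le_one_right (pow_nonneg hγ.1 t) ?_
  refine (abs_sum_mul_le_sum_abs hc _).trans (le_of_eq ?_)
  simpa only [abs_of_nonneg (hnonneg _ _)] using hsum

theorem hasSum_succ_mul_geometric {γ : ℝ} (hγ : γ ∈ Set.Ico (0 : ℝ) 1) :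
    HasSum (fun t : ℕ => γ ^ t * (t + 1 : ℝ)) (1 / (1 - γ) ^ 2) := by
  have hnorm : ‖γ‖ < 1 := by rw [Real.norm_of_nonneg hγ.1]; exact hγ.2
  simpa [mul_comm] using hasSum_choose_mul_geometric_of_norm_lt_one 1 hnorm

/-- The value function is Lipschitz with respect to the supremum over states of the `ℓ¹` distance
of the action distributions. -/
theorem abs_Vval_sub_le {γ : ℝ} (hγ : γ ∈ Set.Ico (0 : ℝ) 1) {P : S → A → S → ℝ}
    (hP : IsKernel P) {ρ : S → ℝ} (hρ : IsDist ρ) {c : S → A → ℝ} (hc : ∀ s a, |c s a| ≤ 1)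
    {π₁ π₂ : S → A → ℝ} (h₁ : IsPolicy π₁) (h₂ : IsPolicy π₂) {D : ℝ}
    (hD : ∀ s, ∑ a, |π₁ s a - π₂ s a| ≤ D) :
    |Vval γ P π₁ ρ c - Vval γ P π₂ ρ c| ≤ 1 / (1 - γ) ^ 2 * D := by
  unfold Vval dsum
  rw [← (summable_discounted_trajSA hγ hP h₁ hρ hc).tsum_sub
    (summable_discounted_trajSA hγ hP h₂ hρ hc), ← Real.norm_eq_abs]
  refine tsum_of_norm_bounded ((hasSum_succ_mul_geometric hγ).mul_right D) fun t => ?_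
  rw [← mul_sub, Real.norm_eq_abs, abs_mul, abs_of_nonneg (pow_nonneg hγ.1 t), mul_assoc]
  refine mul_le_mul_of_nonneg_left ?_ (pow_nonneg hγ.1 t)
  simp only [← Finset.sum_sub_distrib, ← sub_mul]
  exact (abs_sum_mul_le_sum_abs hc _).trans (sum_abs_trajSA_sub_le hP hρ h₁ h₂ hD t)

theorem sum_abs_le_sqrt_card_mul_polNorm2 (x : S → A → ℝ) (s : S) :
    ∑ a, |x s a| ≤ Real.sqrt (Fintype.card A) * polNorm2 x := by
  rw [polNorm2, ← Real.sqrt_mul (Nat.cast_nonneg _)]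
  refine Real.le_sqrt_of_sq_le ((sq_sum_le_card_mul_sum_sq (s := Finset.univ)).trans ?_)
  rw [Finset.card_univ]
  refine mul_le_mul_of_nonneg_left ?_ (Nat.cast_nonneg _)
  simp only [sq_abs]
  exact Finset.single_le_sum (f := fun s => ∑ a, x s a ^ 2)
    (fun s _ => Finset.sum_nonneg fun a _ => sq_nonneg _) (Finset.mem_univ s)

end StateActionDistributions

/-- Lemma 1: Lipschitz continuity of the value function in the policy:
`|V^{π₁}(ρ) − V^{π₂}(ρ)| ≤ (√|A|/(1−γ)²)·‖π₁ − π₂‖₂`. -/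
theorem value_lipschitz_in_policy
    {S A : Type} [Fintype S] [Fintype A]
    (P : S → A → S → ℝ) (r : S → A → ℝ) (γ : ℝ) (ρ : S → ℝ)
    (hP : IsKernel P) (hr : ∀ s a, r s a ∈ Set.Icc (0 : ℝ) 1)
    (hγ : γ ∈ Set.Ico (0 : ℝ) 1) (hρ : IsDist ρ)
    (π₁ π₂ : S → A → ℝ) (h₁ : IsPolicy π₁) (h₂ : IsPolicy π₂) :
    |Vval γ P π₁ ρ r - Vval γ P π₂ ρ r| ≤
      (Real.sqrt (Fintype.card A) / (1 - γ) ^ 2) *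
        polNorm2 (fun s a => π₁ s a - π₂ s a) := by
  rw [div_mul_eq_mul_div, ← one_div_mul_eq_div]
  exact abs_Vval_sub_le hγ hP hρ
    (fun s a => abs_le.2 ⟨by linarith [(hr s a).1], (hr s a).2⟩) h₁ h₂
    (sum_abs_le_sqrt_card_mul_polNorm2 fun s a => π₁ s a - π₂ s a)
end

section
/- Viewing V^π(ρ) as a function of the policy vector π (direct parameterization, over policies whose entries are all positive), its partial derivatives are ∂V^π(ρ)/∂π(a|s) = (1/(1−γ))·d_ρ^π(s)·Q^π(s,a), and the Euclidean norm of the gradient satisfies ‖∇_π V^π(ρ)‖₂ ≤ √|A|/(1−γ)². -/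
open scoped BigOperators

section Discounted

lemma IsPolicy.sum_abs_le {S A : Type} [Fintype A] {π : S → A → ℝ} (hπ : IsPolicy π) (s : S) :
    ∑ a, |π s a| ≤ 1 := by
  simp only [abs_of_nonneg (hπ.1 _ _), hπ.2, le_refl]

lemma sum_abs_add_smul_diracSA_le {S A : Type} [Fintype A] [DecidableEq S] [DecidableEq A]
    {π : S → A → ℝ} (hπ : IsPolicy π) (s : S) (a : A) (h : ℝ) (s' : S) :
    ∑ a', |(π + h • diracSA s a) s' a'| ≤ 1 + |h| := by
  calc _ ≤ ∑ a', (|π s' a'| + |h| * diracSA s a s' a') := by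
        refine Finset.sum_le_sum fun a' _ => (abs_add_le _ _).trans (le_of_eq ?_)
        simp only [Pi.smul_apply, smul_eq_mul, abs_mul, diracSA]
        split_ifs <;> simp
    _ ≤ 1 + |h| := by
        rw [Finset.sum_add_distrib, ← Finset.mul_sum]
        refine add_le_add (hπ.sum_abs_le s') (mul_le_of_le_one_right (abs_nonneg h) ?_)
        simp only [diracSA, ite_and]
        split_ifs <;> simp

variable {S A : Type} [Fintype S] [Fintype A] {P : S → A → S → ℝ} {π π' : S → A → ℝ} {γ B : ℝ}

lemma sum_abs_trajSA_le (hP : IsKernel P) (hB : ∀ s, ∑ a, |π s a| ≤ B) (hB0 : 0 ≤ B)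
    (μ : S → A → ℝ) (t : ℕ) :
    ∑ s, ∑ a, |trajSA P π μ t s a| ≤ B ^ t * ∑ s, ∑ a, |μ s a| := by
  induction t with
  | zero => simp [trajSA]
  | succ t ih =>
    set ν := trajSA P π μ t with hν
    have hstep : ∑ s, ∑ a, |stepDist P π ν s a| ≤ B * ∑ s, ∑ a, |ν s a| := by
      calc ∑ s, ∑ a, |stepDist P π ν s a|
          = ∑ s, |∑ s', ∑ a', ν s' a' * P s' a' s| * ∑ a, |π s a| := by
            simp only [stepDist, abs_mul, Finset.mul_sum]
        _ ≤ ∑ s, (∑ s', ∑ a', |ν s' a'| * P s' a' s) * B := by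
            refine Finset.sum_le_sum fun s _ => mul_le_mul ?_ (hB s)
              (Finset.sum_nonneg fun _ _ => abs_nonneg _)
              (Finset.sum_nonneg fun _ _ => Finset.sum_nonneg fun _ _ =>
                mul_nonneg (abs_nonneg _) (hP.1 _ _ _))
            refine (Finset.abs_sum_le_sum_abs _ _).trans (Finset.sum_le_sum fun s' _ => ?_)
            refine (Finset.abs_sum_le_sum_abs _ _).trans (Finset.sum_le_sum fun a' _ => ?_)
            rw [abs_mul, abs_of_nonneg (hP.1 _ _ _)]
        _ = B * ∑ s', ∑ a', |ν s' a'| := by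
            rw [← Finset.sum_mul, mul_comm, Finset.sum_comm]
            congr 1
            refine Finset.sum_congr rfl fun s' _ => ?_
            rw [Finset.sum_comm]
            refine Finset.sum_congr rfl fun a' _ => ?_
            rw [← Finset.mul_sum, hP.2, mul_one]
    calc _ ≤ B * ∑ s, ∑ a, |ν s a| := hstep
      _ ≤ B * (B ^ t * ∑ s, ∑ a, |μ s a|) := mul_le_mul_of_nonneg_left ih hB0
      _ = _ := by ring

lemma abs_pairing_le (μ c : S → A → ℝ) {C : ℝ} (hc : ∀ s a, |c s a| ≤ C) :
    |∑ s, ∑ a, μ s a * c s a| ≤ C * ∑ s, ∑ a, |μ s a| := by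
  rw [Finset.mul_sum]
  refine (Finset.abs_sum_le_sum_abs _ _).trans (Finset.sum_le_sum fun s _ => ?_)
  rw [Finset.mul_sum]
  refine (Finset.abs_sum_le_sum_abs _ _).trans (Finset.sum_le_sum fun a _ => ?_)
  rw [abs_mul, mul_comm]
  exact mul_le_mul_of_nonneg_right (hc s a) (abs_nonneg _)

lemma exists_abs_le (c : S → A → ℝ) : ∃ C, ∀ s a, |c s a| ≤ C :=
  ⟨∑ s, ∑ a, |c s a|, fun s a =>
    (Finset.single_le_sum (f := fun a => |c s a|) (fun _ _ => abs_nonneg _)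
      (Finset.mem_univ a)).trans
    (Finset.single_le_sum (f := fun s => ∑ a, |c s a|)
      (fun _ _ => Finset.sum_nonneg fun _ _ => abs_nonneg _) (Finset.mem_univ s))⟩

lemma abs_discounted_term_le (hP : IsKernel P) (hγ : 0 ≤ γ) (hB : ∀ s, ∑ a, |π s a| ≤ B)
    (hB0 : 0 ≤ B) (μ : S → A → ℝ) {c : S → A → ℝ} {C : ℝ} (hC0 : 0 ≤ C)
    (hc : ∀ s a, |c s a| ≤ C) (t : ℕ) :
    |γ ^ t * ∑ s, ∑ a, trajSA P π μ t s a * c s a| ≤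
      C * (∑ s, ∑ a, |μ s a|) * (γ * B) ^ t := by
  rw [abs_mul, abs_of_nonneg (pow_nonneg hγ t)]
  calc _ ≤ γ ^ t * (C * (B ^ t * ∑ s, ∑ a, |μ s a|)) := by
        refine mul_le_mul_of_nonneg_left ((abs_pairing_le _ _ hc).trans ?_) (pow_nonneg hγ t)
        exact mul_le_mul_of_nonneg_left (sum_abs_trajSA_le hP hB hB0 μ t) hC0
    _ = _ := by rw [mul_pow]; ring

lemma summable_discounted (hP : IsKernel P) (hγ : 0 ≤ γ) (hB : ∀ s, ∑ a, |π s a| ≤ B)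
    (hB0 : 0 ≤ B) (hγB : γ * B < 1) (μ c : S → A → ℝ) :
    Summable fun t : ℕ => γ ^ t * ∑ s, ∑ a, trajSA P π μ t s a * c s a := by
  obtain ⟨C, hC⟩ := exists_abs_le c
  refine Summable.of_norm_bounded
    ((summable_geometric_of_lt_one (mul_nonneg hγ hB0) hγB).mul_left _)
    fun t => abs_discounted_term_le (C := |C|) hP hγ hB hB0 μ (abs_nonneg C)
      (fun s a => (hC s a).trans (le_abs_self C)) t

lemma stepDist_add_smul (μ ν : S → A → ℝ) (k : ℝ) :
    stepDist P π (μ + k • ν) = stepDist P π μ + k • stepDist P π ν := by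
  funext s a
  simp only [stepDist, Pi.add_apply, Pi.smul_apply, smul_eq_mul, add_mul, Finset.sum_add_distrib,
    mul_assoc, Finset.mul_sum, Finset.sum_mul]

lemma trajSA_add_smul (μ ν : S → A → ℝ) (k : ℝ) (t : ℕ) :
    trajSA P π (μ + k • ν) t = trajSA P π μ t + k • trajSA P π ν t := by
  induction t with
  | zero => rfl
  | succ t ih => simp only [trajSA, ih, stepDist_add_smul]

lemma trajSA_stepDist (μ : S → A → ℝ) (t : ℕ) :
    trajSA P π (stepDist P π μ) t = trajSA P π μ (t + 1) := by
  induction t with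
  | zero => rfl
  | succ t ih => rw [trajSA, ih]; rfl

lemma dsum_add_smul (hP : IsKernel P) (hγ : 0 ≤ γ) (hB : ∀ s, ∑ a, |π s a| ≤ B)
    (hB0 : 0 ≤ B) (hγB : γ * B < 1) (μ ν c : S → A → ℝ) (k : ℝ) :
    dsum γ P π (μ + k • ν) c = dsum γ P π μ c + k * dsum γ P π ν c := by
  have hμ := summable_discounted hP hγ hB hB0 hγB μ c
  have hν := summable_discounted hP hγ hB hB0 hγB ν c
  unfold dsum
  rw [← tsum_mul_left, ← hμ.tsum_add (hν.mul_left k)]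
  refine tsum_congr fun t => ?_
  simp only [trajSA_add_smul, Pi.add_apply, Pi.smul_apply, smul_eq_mul, add_mul,
    Finset.sum_add_distrib, mul_assoc, ← Finset.mul_sum]
  ring

lemma dsum_eq_add_stepDist (hP : IsKernel P) (hγ : 0 ≤ γ) (hB : ∀ s, ∑ a, |π s a| ≤ B)
    (hB0 : 0 ≤ B) (hγB : γ * B < 1) (μ c : S → A → ℝ) :
    dsum γ P π μ c = ∑ s, ∑ a, μ s a * c s a + γ * dsum γ P π (stepDist P π μ) c := by
  unfold dsum
  rw [(summable_discounted hP hγ hB hB0 hγB μ c).tsum_eq_zero_add, ← tsum_mul_left]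
  simp only [trajSA_stepDist, pow_succ']
  simp [trajSA, mul_assoc]

/-- Discounted occupation of the state `s` at times `t ≥ 1`. -/
noncomputable def laterOccupation (γ : ℝ) (P : S → A → S → ℝ) (π μ : S → A → ℝ) (s : S) : ℝ :=
  ∑' t : ℕ, γ ^ (t + 1) * ∑ s', ∑ a', trajSA P π μ t s' a' * P s' a' s

lemma tendsto_discounted_dsum (hP : IsKernel P) (hγ : 0 ≤ γ) {B' : ℝ}
    (hB : ∀ s, ∑ a, |π s a| ≤ B) (hB0 : 0 ≤ B) (hγB : γ * B < 1)
    (hB' : ∀ s, ∑ a, |π' s a| ≤ B') (hB0' : 0 ≤ B') (hγB' : γ * B' < 1) (μ c : S → A → ℝ) :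
    Filter.Tendsto (fun t : ℕ => γ ^ t * dsum γ P π' (trajSA P π μ t) c) Filter.atTop (nhds 0) := by
  obtain ⟨C, hC⟩ := exists_abs_le c
  have hC' : ∀ s a, |c s a| ≤ |C| := fun s a => (hC s a).trans (le_abs_self C)
  have hgeom := tendsto_pow_atTop_nhds_zero_of_lt_one (mul_nonneg hγ hB0) hγB
  refine squeeze_zero_norm
    (a := fun t => |C| * (∑ s, ∑ a, |μ s a|) * (1 - γ * B')⁻¹ * (γ * B) ^ t) (fun t => ?_)
    (by simpa using hgeom.const_mul (|C| * (∑ s, ∑ a, |μ s a|) * (1 - γ * B')⁻¹))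
  have hW : |dsum γ P π' (trajSA P π μ t) c| ≤
      |C| * (∑ s, ∑ a, |trajSA P π μ t s a|) * (1 - γ * B')⁻¹ := by
    rw [dsum, ← Real.norm_eq_abs]
    exact tsum_of_norm_bounded
      ((hasSum_geometric_of_lt_one (mul_nonneg hγ hB0') hγB').mul_left _)
      fun n => abs_discounted_term_le hP hγ hB' hB0' _ (abs_nonneg C) hC' n
  rw [Real.norm_eq_abs, abs_mul, abs_of_nonneg (pow_nonneg hγ t)]
  calc _ ≤ γ ^ t * (|C| * (B ^ t * ∑ s, ∑ a, |μ s a|) * (1 - γ * B')⁻¹) := by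
        refine mul_le_mul_of_nonneg_left (hW.trans ?_) (pow_nonneg hγ t)
        refine mul_le_mul_of_nonneg_right ?_ (inv_nonneg.2 (by linarith))
        exact mul_le_mul_of_nonneg_left (sum_abs_trajSA_le hP hB hB0 μ t) (abs_nonneg C)
    _ = _ := by rw [mul_pow]; ring

/-- Performance difference identity for two policies that differ in one entry. -/
lemma dsum_sub_dsum_of_eq_add_diracSA [DecidableEq S] [DecidableEq A] (hP : IsKernel P)
    (hγ : 0 ≤ γ) {B' : ℝ} (hB : ∀ s, ∑ a, |π s a| ≤ B) (hB0 : 0 ≤ B) (hγB : γ * B < 1)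
    (hB' : ∀ s, ∑ a, |π' s a| ≤ B') (hB0' : 0 ≤ B') (hγB' : γ * B' < 1)
    {s : S} {a : A} {h : ℝ} (hπ' : π' = π + h • diracSA s a) (μ c : S → A → ℝ) :
    dsum γ P π' μ c - dsum γ P π μ c =
      h * laterOccupation γ P π μ s * dsum γ P π' (diracSA s a) c := by
  set W := fun ν => dsum γ P π' ν c with hW
  set m := fun t : ℕ => ∑ s', ∑ a', trajSA P π μ t s' a' * P s' a' s with hm
  have hstep (t : ℕ) : stepDist P π' (trajSA P π μ t) =
      trajSA P π μ (t + 1) + (h * m t) • diracSA s a := by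
    funext s' a'
    simp only [hπ', trajSA, stepDist, hm, diracSA, Pi.add_apply, Pi.smul_apply, smul_eq_mul]
    split_ifs with hs
    · rw [hs.1]; ring
    · ring
  have hterm (t : ℕ) : γ ^ t * ∑ s, ∑ a, trajSA P π μ t s a * c s a =
      (γ ^ t * W (trajSA P π μ t) - γ ^ (t + 1) * W (trajSA P π μ (t + 1))) -
        h * W (diracSA s a) * (γ ^ (t + 1) * m t) := by
    have := dsum_eq_add_stepDist hP hγ hB' hB0' hγB' (trajSA P π μ t) c
    rw [hstep, dsum_add_smul hP hγ hB' hB0' hγB'] at this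
    simp only [hW]
    rw [this]
    ring
  have hmsum : Summable fun t : ℕ => γ ^ (t + 1) * m t := by
    simpa only [pow_succ', mul_assoc] using
      (summable_discounted hP hγ hB hB0 hγB μ (fun s' a' => P s' a' s)).mul_left γ
  have htel : HasSum (fun t : ℕ =>
      γ ^ t * W (trajSA P π μ t) - γ ^ (t + 1) * W (trajSA P π μ (t + 1))) (W μ) := by
    have hs : Summable (fun t : ℕ =>
        γ ^ t * W (trajSA P π μ t) - γ ^ (t + 1) * W (trajSA P π μ (t + 1))) := by
      refine ((summable_discounted hP hγ hB hB0 hγB μ c).add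
        (hmsum.mul_left (h * W (diracSA s a)))).congr fun t => ?_
      rw [hterm]; ring
    rw [hs.hasSum_iff_tendsto_nat]
    simp only [Finset.sum_range_sub' (fun t => γ ^ t * W (trajSA P π μ t))]
    simpa [trajSA] using
      (tendsto_discounted_dsum hP hγ hB hB0 hγB hB' hB0' hγB' μ c).const_sub (W μ)
  have hsum : dsum γ P π μ c = W μ - h * W (diracSA s a) * laterOccupation γ P π μ s := by
    refine HasSum.tsum_eq ?_
    simp only [hterm]
    exact htel.sub (hmsum.hasSum.mul_left _)
  rw [hsum]
  simp only [hW]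
  ring

lemma sum_trajSA_succ (hπ : IsPolicy π) (μ : S → A → ℝ) (t : ℕ) (s : S) :
    ∑ a, trajSA P π μ (t + 1) s a = ∑ s', ∑ a', trajSA P π μ t s' a' * P s' a' s := by
  simp only [trajSA, stepDist]
  rw [← Finset.mul_sum, hπ.2, mul_one]

lemma trajSA_nonneg (hP : IsKernel P) (hπ : IsPolicy π) {μ : S → A → ℝ}
    (hμ : ∀ s a, 0 ≤ μ s a) (t : ℕ) (s : S) (a : A) : 0 ≤ trajSA P π μ t s a := by
  induction t generalizing s a with
  | zero => exact hμ s a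
  | succ t ih =>
    exact mul_nonneg (Finset.sum_nonneg fun s' _ => Finset.sum_nonneg fun a' _ =>
      mul_nonneg (ih s' a') (hP.1 _ _ _)) (hπ.1 s a)

lemma summable_visit (hP : IsKernel P) (hγ : γ ∈ Set.Ico (0 : ℝ) 1) (hπ : IsPolicy π)
    (μ : S → A → ℝ) (s : S) : Summable fun t : ℕ => γ ^ t * ∑ a, trajSA P π μ t s a := by
  classical
  refine (summable_discounted hP hγ.1 hπ.sum_abs_le zero_le_one (by simpa using hγ.2) μ
    (fun s' _ => if s' = s then 1 else 0)).congr fun t => ?_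
  simp

lemma visit_eq (hP : IsKernel P) (hγ : γ ∈ Set.Ico (0 : ℝ) 1) (hπ : IsPolicy π) (ρ : S → ℝ)
    (s : S) :
    visit γ P π ρ s = (1 - γ) * (ρ s + laterOccupation γ P π (initSA ρ π) s) := by
  rw [visit, (summable_visit hP hγ hπ _ s).tsum_eq_zero_add, laterOccupation]
  simp only [sum_trajSA_succ hπ]
  simp [trajSA, initSA, ← Finset.mul_sum, hπ.2]

lemma visit_nonneg (hP : IsKernel P) (hγ : γ ∈ Set.Ico (0 : ℝ) 1) (hπ : IsPolicy π) {ρ : S → ℝ}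
    (hρ : IsDist ρ) (s : S) : 0 ≤ visit γ P π ρ s :=
  mul_nonneg (by linarith [hγ.2]) (tsum_nonneg fun t => mul_nonneg (pow_nonneg hγ.1 t)
    (Finset.sum_nonneg fun a _ => trajSA_nonneg hP hπ
      (fun s a => mul_nonneg (hρ.1 s) (hπ.1 s a)) t s a))

lemma abs_dsum_le (hP : IsKernel P) (hγ : γ ∈ Set.Ico (0 : ℝ) 1) (hπ : IsPolicy π)
    {μ c : S → A → ℝ} (hμ : ∑ s, ∑ a, |μ s a| ≤ 1) (hc : ∀ s a, |c s a| ≤ 1) :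
    |dsum γ P π μ c| ≤ (1 - γ)⁻¹ := by
  rw [dsum, ← Real.norm_eq_abs]
  refine tsum_of_norm_bounded (hasSum_geometric_of_lt_one hγ.1 hγ.2) fun t => ?_
  refine (abs_discounted_term_le hP hγ.1 hπ.sum_abs_le zero_le_one μ zero_le_one hc t).trans ?_
  rw [one_mul, mul_one]
  exact mul_le_of_le_one_left (pow_nonneg hγ.1 t) hμ

lemma sum_visit_le_one (hP : IsKernel P) (hγ : γ ∈ Set.Ico (0 : ℝ) 1) (hπ : IsPolicy π)
    {ρ : S → ℝ} (hρ : IsDist ρ) : ∑ s, visit γ P π ρ s ≤ 1 := by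
  have hsum : ∑ s, visit γ P π ρ s = (1 - γ) * dsum γ P π (initSA ρ π) (fun _ _ => 1) := by
    unfold visit dsum
    rw [← Finset.mul_sum, ← Summable.tsum_finsetSum fun s _ => summable_visit hP hγ hπ _ s]
    simp only [mul_one, Finset.mul_sum]
  have hinit : ∑ s, ∑ a, |initSA ρ π s a| ≤ 1 := by
    simp only [initSA, abs_mul, abs_of_nonneg (hρ.1 _), abs_of_nonneg (hπ.1 _ _),
      ← Finset.mul_sum, hπ.2, mul_one, hρ.2, le_refl]
  have hγ1 : 0 < 1 - γ := by linarith [hγ.2]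
  calc _ ≤ (1 - γ) * (1 - γ)⁻¹ := by
        rw [hsum]
        exact mul_le_mul_of_nonneg_left
          ((le_abs_self _).trans (abs_dsum_le hP hγ hπ hinit (by simp))) hγ1.le
    _ = 1 := mul_inv_cancel₀ hγ1.ne'

lemma abs_Qval_le [DecidableEq S] [DecidableEq A] (hP : IsKernel P)
    (hγ : γ ∈ Set.Ico (0 : ℝ) 1) (hπ : IsPolicy π) {c : S → A → ℝ} (hc : ∀ s a, |c s a| ≤ 1)
    (s : S) (a : A) : |Qval γ P π s a c| ≤ (1 - γ)⁻¹ := by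
  refine abs_dsum_le hP hγ hπ (le_of_eq ?_) hc
  simp only [diracSA, apply_ite abs, abs_one, abs_zero, ite_and]
  simp

lemma polNorm2_visit_mul_Qval_le [DecidableEq S] [DecidableEq A] (hP : IsKernel P)
    (hγ : γ ∈ Set.Ico (0 : ℝ) 1) (hπ : IsPolicy π) {ρ : S → ℝ} (hρ : IsDist ρ)
    {c : S → A → ℝ} (hc : ∀ s a, |c s a| ≤ 1) :
    polNorm2 (fun s a => (1 / (1 - γ)) * visit γ P π ρ s * Qval γ P π s a c) ≤
      Real.sqrt (Fintype.card A) / (1 - γ) ^ 2 := by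
  have hγ1 : 0 < 1 - γ := by linarith [hγ.2]
  have hv := visit_nonneg hP hγ hπ hρ
  have hv1 := sum_visit_le_one hP hγ hπ hρ
  have hsq : ∑ s, visit γ P π ρ s ^ 2 ≤ 1 := by
    refine le_trans (Finset.sum_le_sum fun s _ => ?_) hv1
    have := (Finset.single_le_sum (fun s _ => hv s) (Finset.mem_univ s)).trans hv1
    exact pow_le_of_le_one (hv s) this two_ne_zero
  refine Real.sqrt_le_iff.2 ⟨by positivity, ?_⟩
  rw [div_pow, Real.sq_sqrt (Nat.cast_nonneg _)]
  calc ∑ s, ∑ a, (1 / (1 - γ) * visit γ P π ρ s * Qval γ P π s a c) ^ 2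
      ≤ ∑ s, ∑ _a : A, visit γ P π ρ s ^ 2 * (1 / ((1 - γ) ^ 2) ^ 2) := by
        refine Finset.sum_le_sum fun s _ => Finset.sum_le_sum fun a _ => ?_
        have hQ : Qval γ P π s a c ^ 2 ≤ ((1 - γ)⁻¹) ^ 2 :=
          sq_le_sq' (neg_le_of_abs_le (abs_Qval_le hP hγ hπ hc s a))
            (le_of_abs_le (abs_Qval_le hP hγ hπ hc s a))
        calc _ = (1 / (1 - γ) * visit γ P π ρ s) ^ 2 * Qval γ P π s a c ^ 2 := by ring
          _ ≤ (1 / (1 - γ) * visit γ P π ρ s) ^ 2 * ((1 - γ)⁻¹) ^ 2 := by gcongr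
          _ = _ := by field_simp
    _ = (∑ s, visit γ P π ρ s ^ 2) * (Fintype.card A / ((1 - γ) ^ 2) ^ 2) := by
        simp only [Finset.sum_const, Finset.card_univ, nsmul_eq_mul, Finset.sum_mul]
        refine Finset.sum_congr rfl fun s _ => ?_
        ring
    _ ≤ Fintype.card A / ((1 - γ) ^ 2) ^ 2 := mul_le_of_le_one_left (by positivity) hsq

lemma hasDerivAt_Vval [DecidableEq S] [DecidableEq A] (hP : IsKernel P)
    (hγ : γ ∈ Set.Ico (0 : ℝ) 1) (hπ : IsPolicy π) (ρ : S → ℝ) (c : S → A → ℝ) (s : S) (a : A) :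
    HasDerivAt
      (fun x : ℝ => Vval γ P (fun s' a' => if s' = s ∧ a' = a then x else π s' a') ρ c)
      ((1 / (1 - γ)) * visit γ P π ρ s * Qval γ P π s a c) (π s a) := by
  have hγ1 : 0 < 1 - γ := by linarith [hγ.2]
  set M := laterOccupation γ P π (diracSA s a) s with hM
  set D := 1 / (1 - γ) * visit γ P π ρ s with hD
  have hD' : D = ρ s + laterOccupation γ P π (initSA ρ π) s := by
    rw [hD, visit_eq hP hγ hπ]; field_simp
  have hpert (x : ℝ) : (fun s' a' => if s' = s ∧ a' = a then x else π s' a') =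
      π + (x - π s a) • diracSA s a := by
    funext s' a'
    simp only [diracSA, Pi.add_apply, Pi.smul_apply, smul_eq_mul]
    split_ifs with hs
    · rw [hs.1, hs.2]; ring
    · ring
  simp only [hpert]
  have hnear : ∀ᶠ x in nhds (π s a), γ * (1 + |x - π s a|) < 1 ∧ (x - π s a) * M < 1 := by
    refine Filter.Eventually.and ?_ ?_
    · exact ContinuousAt.eventually_lt (by fun_prop) continuousAt_const (by simpa using hγ.2)
    · exact ContinuousAt.eventually_lt (by fun_prop) continuousAt_const (by simp)
  have hformula : ∀ᶠ x in nhds (π s a), Vval γ P (π + (x - π s a) • diracSA s a) ρ c =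
      Vval γ P π ρ c + (x - π s a) * D * (Qval γ P π s a c / (1 - (x - π s a) * M)) := by
    filter_upwards [hnear] with x ⟨hx, hxM⟩
    set h := x - π s a with hh
    have hB' := sum_abs_add_smul_diracSA_le hπ s a h
    have hB0' : 0 ≤ 1 + |h| := by positivity
    have key := dsum_sub_dsum_of_eq_add_diracSA hP hγ.1 hπ.sum_abs_le zero_le_one
      (by simpa using hγ.2) hB' hB0' hx rfl
    have hQ : dsum γ P (π + h • diracSA s a) (diracSA s a) c =
        Qval γ P π s a c / (1 - h * M) := by
      rw [eq_div_iff (by linarith), Qval]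
      linear_combination key (diracSA s a) c
    have hinit : initSA ρ (π + h • diracSA s a) = initSA ρ π + (ρ s * h) • diracSA s a := by
      funext s' a'
      simp only [initSA, diracSA, Pi.add_apply, Pi.smul_apply, smul_eq_mul]
      split_ifs with hs
      · rw [hs.1]; ring
      · ring
    rw [Vval, hinit, dsum_add_smul hP hγ.1 hB' hB0' hx, ← hQ, hD', Vval]
    linear_combination key (initSA ρ π) c
  refine HasDerivAt.congr_of_eventuallyEq ?_ hformula
  have hid : HasDerivAt (fun x => x - π s a) 1 (π s a) := (hasDerivAt_id _).sub_const _
  have hquot := (hasDerivAt_const (π s a) (Qval γ P π s a c)).div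
    ((hid.mul_const M).const_sub 1) (by simp)
  refine (((hid.mul_const D).mul hquot).const_add (Vval γ P π ρ c)).congr_deriv ?_
  simp

end Discounted

/-- policy gradient for direct parameterization, and gradient-norm bound:
for a policy with positive entries, `∂V^π(ρ)/∂π(a|s) = (1/(1−γ))·d_ρ^π(s)·Q^π(s,a)`, and
`‖∇_π V^π(ρ)‖₂ ≤ √|A|/(1−γ)²`. -/
theorem policy_gradient_direct_param
    {S A : Type} [Fintype S] [Fintype A] [DecidableEq S] [DecidableEq A]
    (P : S → A → S → ℝ) (r : S → A → ℝ) (γ : ℝ) (ρ : S → ℝ)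
    (hP : IsKernel P) (hr : ∀ s a, r s a ∈ Set.Icc (0 : ℝ) 1)
    (hγ : γ ∈ Set.Ico (0 : ℝ) 1) (hρ : IsDist ρ)
    (π : S → A → ℝ) (hπ : IsPolicy π) (hpos : ∀ s a, 0 < π s a) :
    (∀ s a, HasDerivAt
        (fun x : ℝ => Vval γ P (fun s' a' => if s' = s ∧ a' = a then x else π s' a') ρ r)
        ((1 / (1 - γ)) * visit γ P π ρ s * Qval γ P π s a r) (π s a)) ∧
      polNorm2 (fun s a => (1 / (1 - γ)) * visit γ P π ρ s * Qval γ P π s a r) ≤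
        Real.sqrt (Fintype.card A) / (1 - γ) ^ 2 := by
  have hc : ∀ s a, |r s a| ≤ 1 := fun s a => abs_le.2 ⟨by linarith [(hr s a).1], (hr s a).2⟩
  exact ⟨fun s a => hasDerivAt_Vval hP hγ hπ ρ r s a, polNorm2_visit_mul_Qval_le hP hγ hπ hρ hc⟩
end

section
/- Let π*_τ be the optimal policy of the unconstrained entropy-regularized MDP, i.e. the maximizer of V_τ^π(ρ) over all policies (which is unique and has all entries positive). For every policy π, the soft sub-optimality identity holds: V_τ^{π*_τ}(ρ) − V_τ^π(ρ) = (τ/(1−γ))·Σ_{s∈S} d_ρ^π(s)·D_KL(π(·|s) ‖ π*_τ(·|s)), where D_KL(p‖q) = Σ_x p(x)·(log p(x) − log q(x)). -/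
open scoped BigOperators

section CMDP

variable {S A : Type} [Fintype S] [Fintype A]

/-- Unnormalized discounted state occupancy `∑ γ^t Pr(s_t = s)`. -/
noncomputable def occupancy (γ : ℝ) (P : S → A → S → ℝ) (π : S → A → ℝ) (ρ : S → ℝ)
    (s : S) : ℝ :=
  ∑' t : ℕ, γ ^ t * ∑ a, trajSA P π (initSA ρ π) t s a

lemma trajSA_eq_marginal_mul (P : S → A → S → ℝ) {π : S → A → ℝ} (ρ : S → ℝ)
    (hπ : IsPolicy π) (t : ℕ) (s : S) (a : A) :
    trajSA P π (initSA ρ π) t s a = (∑ a', trajSA P π (initSA ρ π) t s a') * π s a := by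
  cases t <;> simp [trajSA, initSA, stepDist, ← Finset.mul_sum, hπ.2 s]

lemma marginal_trajSA_succ (P : S → A → S → ℝ) {π : S → A → ℝ} (ρ : S → ℝ)
    (hπ : IsPolicy π) (t : ℕ) (s : S) :
    ∑ a, trajSA P π (initSA ρ π) (t + 1) s a =
      ∑ s', (∑ a', trajSA P π (initSA ρ π) t s' a') * ∑ a', π s' a' * P s' a' s := by
  simp only [trajSA, stepDist, ← Finset.mul_sum, hπ.2 s, mul_one]
  refine Finset.sum_congr rfl fun s' _ => ?_
  rw [Finset.mul_sum]
  refine Finset.sum_congr rfl fun a' _ => ?_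
  rw [trajSA_eq_marginal_mul P ρ hπ, mul_assoc]

lemma marginal_trajSA_nonneg {P : S → A → S → ℝ} {π : S → A → ℝ} {ρ : S → ℝ}
    (hP : IsKernel P) (hπ : IsPolicy π) (hρ : IsDist ρ) (t : ℕ) (s : S) :
    0 ≤ ∑ a, trajSA P π (initSA ρ π) t s a := by
  induction t generalizing s with
  | zero => exact Finset.sum_nonneg fun a _ => mul_nonneg (hρ.1 s) (hπ.1 s a)
  | succ t ih =>
    rw [marginal_trajSA_succ P ρ hπ]
    exact Finset.sum_nonneg fun s' _ => mul_nonneg (ih s')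
      (Finset.sum_nonneg fun a' _ => mul_nonneg (hπ.1 s' a') (hP.1 s' a' s))

lemma sum_marginal_trajSA {P : S → A → S → ℝ} {π : S → A → ℝ} {ρ : S → ℝ}
    (hP : IsKernel P) (hπ : IsPolicy π) (hρ : IsDist ρ) (t : ℕ) :
    ∑ s, ∑ a, trajSA P π (initSA ρ π) t s a = 1 := by
  induction t with
  | zero => simp [trajSA, initSA, ← Finset.mul_sum, hπ.2, hρ.2]
  | succ t ih =>
    simp only [marginal_trajSA_succ P ρ hπ]
    rw [Finset.sum_comm, ← ih]
    refine Finset.sum_congr rfl fun s' _ => ?_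
    rw [← Finset.mul_sum, Finset.sum_comm]
    simp [← Finset.mul_sum, hP.2, hπ.2]

lemma summable_discounted_marginal {γ : ℝ} {P : S → A → S → ℝ} {π : S → A → ℝ} {ρ : S → ℝ}
    (hγ : γ ∈ Set.Ico (0 : ℝ) 1) (hP : IsKernel P) (hπ : IsPolicy π) (hρ : IsDist ρ) (s : S) :
    Summable fun t : ℕ => γ ^ t * ∑ a, trajSA P π (initSA ρ π) t s a := by
  refine Summable.of_nonneg_of_le
    (fun t => mul_nonneg (pow_nonneg hγ.1 t) (marginal_trajSA_nonneg hP hπ hρ t s))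
    (fun t => ?_) (summable_geometric_of_lt_one hγ.1 hγ.2)
  refine mul_le_of_le_one_right (pow_nonneg hγ.1 t) ?_
  rw [← sum_marginal_trajSA hP hπ hρ t]
  exact Finset.single_le_sum (f := fun s => ∑ a, trajSA P π (initSA ρ π) t s a)
    (fun s _ => marginal_trajSA_nonneg hP hπ hρ t s) (Finset.mem_univ s)

lemma occupancy_nonneg {γ : ℝ} {P : S → A → S → ℝ} {π : S → A → ℝ} {ρ : S → ℝ}
    (hγ : γ ∈ Set.Ico (0 : ℝ) 1) (hP : IsKernel P) (hπ : IsPolicy π) (hρ : IsDist ρ) (s : S) :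
    0 ≤ occupancy γ P π ρ s :=
  tsum_nonneg fun t => mul_nonneg (pow_nonneg hγ.1 t) (marginal_trajSA_nonneg hP hπ hρ t s)

lemma Vval_eq_sum_occupancy {γ : ℝ} {P : S → A → S → ℝ} {π : S → A → ℝ} {ρ : S → ℝ}
    (hγ : γ ∈ Set.Ico (0 : ℝ) 1) (hP : IsKernel P) (hπ : IsPolicy π) (hρ : IsDist ρ)
    (c : S → A → ℝ) :
    Vval γ P π ρ c = ∑ s, occupancy γ P π ρ s * ∑ a, π s a * c s a := by
  unfold Vval dsum occupancy
  simp only [← tsum_mul_right]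
  rw [← Summable.tsum_finsetSum
    fun s _ => (summable_discounted_marginal hγ hP hπ hρ s).mul_right _]
  refine tsum_congr fun t => ?_
  rw [Finset.mul_sum]
  refine Finset.sum_congr rfl fun s _ => ?_
  rw [mul_assoc, Finset.mul_sum Finset.univ (fun a => π s a * c s a)]
  congr 1
  refine Finset.sum_congr rfl fun a _ => ?_
  rw [trajSA_eq_marginal_mul P ρ hπ, mul_assoc]

/-- Bellman flow equation for the occupancy measure. -/
lemma occupancy_eq {γ : ℝ} {P : S → A → S → ℝ} {π : S → A → ℝ} {ρ : S → ℝ}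
    (hγ : γ ∈ Set.Ico (0 : ℝ) 1) (hP : IsKernel P) (hπ : IsPolicy π) (hρ : IsDist ρ) (s : S) :
    occupancy γ P π ρ s =
      ρ s + γ * ∑ s', occupancy γ P π ρ s' * ∑ a', π s' a' * P s' a' s := by
  conv_lhs => rw [occupancy, (summable_discounted_marginal hγ hP hπ hρ s).tsum_eq_zero_add]
  congr 1
  · simp [trajSA, initSA, ← Finset.mul_sum, hπ.2]
  · unfold occupancy
    simp only [← tsum_mul_right]
    rw [← Summable.tsum_finsetSum
      fun s' _ => (summable_discounted_marginal hγ hP hπ hρ s').mul_right _, ← tsum_mul_left]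
    refine tsum_congr fun t => ?_
    rw [marginal_trajSA_succ P ρ hπ, pow_succ, Finset.mul_sum, Finset.mul_sum]
    exact Finset.sum_congr rfl fun s' _ => by ring

/-- Telescoping: the discounted sum of `V s_t - γ V s_{t+1}` is `V s_0`, in expectation. -/
lemma sum_occupancy_mul_sub {γ : ℝ} {P : S → A → S → ℝ} {π : S → A → ℝ} {ρ : S → ℝ}
    (hγ : γ ∈ Set.Ico (0 : ℝ) 1) (hP : IsKernel P) (hπ : IsPolicy π) (hρ : IsDist ρ)
    (V : S → ℝ) :
    ∑ s, occupancy γ P π ρ s * ∑ a, π s a * (V s - γ * ∑ s', P s a s' * V s') =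
      ∑ s, ρ s * V s := by
  have h1 : ∀ s, ∑ a, π s a * (V s - γ * ∑ s', P s a s' * V s') =
      V s - γ * ∑ s', (∑ a, π s a * P s a s') * V s' := by
    intro s
    simp only [mul_sub, Finset.sum_sub_distrib, ← Finset.sum_mul, hπ.2 s, one_mul]
    congr 1
    simp only [Finset.mul_sum, Finset.sum_mul]
    rw [Finset.sum_comm]
    exact Finset.sum_congr rfl fun _ _ => Finset.sum_congr rfl fun _ _ => by ring
  have h2 : ∑ s, occupancy γ P π ρ s * V s = ∑ s, ρ s * V s +
      ∑ s, occupancy γ P π ρ s * (γ * ∑ s', (∑ a, π s a * P s a s') * V s') := by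
    conv_lhs =>
      enter [2, s]
      rw [occupancy_eq hγ hP hπ hρ s]
    simp only [add_mul, Finset.sum_add_distrib]
    congr 1
    simp only [Finset.mul_sum, Finset.sum_mul]
    rw [Finset.sum_comm]
    exact Finset.sum_congr rfl fun _ _ => Finset.sum_congr rfl fun _ _ =>
      Finset.sum_congr rfl fun _ _ => by ring
  simp only [h1]
  rw [← sub_eq_iff_eq_add.2 h2, ← Finset.sum_sub_distrib]
  exact Finset.sum_congr rfl fun _ _ => mul_sub _ _ _

lemma Vtau_eq_sum_occupancy {γ : ℝ} {P : S → A → S → ℝ} {π : S → A → ℝ} {ρ : S → ℝ}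
    (hγ : γ ∈ Set.Ico (0 : ℝ) 1) (hP : IsKernel P) (hπ : IsPolicy π) (hρ : IsDist ρ)
    (τ : ℝ) (r : S → A → ℝ) (V : S → ℝ) :
    Vtau γ τ P π ρ r = ∑ s, ρ s * V s + ∑ s, occupancy γ P π ρ s *
      ∑ a, π s a * (r s a + γ * ∑ s', P s a s' * V s' - V s - τ * Real.log (π s a)) := by
  rw [← sum_occupancy_mul_sub hγ hP hπ hρ V, Vtau, Hent, Vval_eq_sum_occupancy hγ hP hπ hρ,
    Vval_eq_sum_occupancy hγ hP hπ hρ, Finset.mul_sum, ← Finset.sum_add_distrib,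
    ← Finset.sum_add_distrib]
  refine Finset.sum_congr rfl fun s _ => ?_
  rw [mul_left_comm, ← mul_add, ← mul_add, Finset.mul_sum, ← Finset.sum_add_distrib,
    ← Finset.sum_add_distrib]
  congr 1
  exact Finset.sum_congr rfl fun a _ => by ring

/-- The Bellman evaluation equation has a solution. -/
lemma exists_bellman_solution {γ : ℝ} {P : S → A → S → ℝ} {π : S → A → ℝ}
    (hγ : γ ∈ Set.Ico (0 : ℝ) 1) (hP : IsKernel P) (hπ : IsPolicy π) (c : S → A → ℝ) :
    ∃ V : S → ℝ, ∀ s, ∑ a, π s a * (c s a + γ * ∑ s', P s a s' * V s') = V s := by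
  let T : (S → ℝ) → S → ℝ := fun V s => ∑ a, π s a * (c s a + γ * ∑ s', P s a s' * V s')
  have hT : ContractingWith ⟨γ, hγ.1⟩ T := by
    refine ⟨by exact_mod_cast hγ.2, LipschitzWith.of_dist_le_mul fun V W => ?_⟩
    have hnn : 0 ≤ γ * dist V W := mul_nonneg hγ.1 dist_nonneg
    refine (dist_pi_le_iff hnn).2 fun s => ?_
    have hdiff : T V s - T W s = ∑ a, π s a * (γ * ∑ s', P s a s' * (V s' - W s')) := by
      simp only [T, mul_sub, Finset.sum_sub_distrib]
      rw [← Finset.sum_sub_distrib, ← Finset.sum_sub_distrib]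
      exact Finset.sum_congr rfl fun a _ => by ring
    rw [Real.dist_eq, hdiff]
    calc |∑ a, π s a * (γ * ∑ s', P s a s' * (V s' - W s'))|
        ≤ ∑ a, π s a * (γ * ∑ s', P s a s' * dist V W) := by
          refine (Finset.abs_sum_le_sum_abs _ _).trans (Finset.sum_le_sum fun a _ => ?_)
          rw [abs_mul, abs_mul, abs_of_nonneg (hπ.1 s a), abs_of_nonneg hγ.1]
          refine mul_le_mul_of_nonneg_left (mul_le_mul_of_nonneg_left ?_ hγ.1) (hπ.1 s a)
          refine (Finset.abs_sum_le_sum_abs _ _).trans (Finset.sum_le_sum fun s' _ => ?_)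
          rw [abs_mul, abs_of_nonneg (hP.1 s a s')]
          refine mul_le_mul_of_nonneg_left ?_ (hP.1 s a s')
          rw [← Real.dist_eq]
          exact dist_le_pi_dist V W s'
      _ = γ * dist V W := by simp [← Finset.sum_mul, hP.2, hπ.2]
  exact ⟨hT.fixedPoint T, fun s => congrFun hT.fixedPoint_isFixedPt s⟩

/-- If `πstar` is the unique maximizer of the regularized value, then its soft advantages vanish:
otherwise reweighting by the exponentiated advantages gives another policy at least as good. -/
lemma soft_advantage_eq_zero {P : S → A → S → ℝ} {r : S → A → ℝ} {γ τ : ℝ} {ρ : S → ℝ}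
    (hP : IsKernel P) (hγ : γ ∈ Set.Ico (0 : ℝ) 1) (hρ : IsDist ρ) (hτ : 0 < τ)
    {πstar : S → A → ℝ} (hstar : IsPolicy πstar) (hstarpos : ∀ s a, 0 < πstar s a)
    (hopt : ∀ π : S → A → ℝ, IsPolicy π → Vtau γ τ P π ρ r ≤ Vtau γ τ P πstar ρ r)
    (huniq : ∀ π : S → A → ℝ, IsPolicy π →
      Vtau γ τ P π ρ r = Vtau γ τ P πstar ρ r → π = πstar)
    {V : S → ℝ} {adv : S → A → ℝ}
    (hadv : ∀ s a, adv s a =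
      r s a + γ * ∑ s', P s a s' * V s' - V s - τ * Real.log (πstar s a))
    (hmean : ∀ s, ∑ a, πstar s a * adv s a = 0) (s : S) (a : A) :
    adv s a = 0 := by
  let Z : S → ℝ := fun s => ∑ a, πstar s a * Real.exp (adv s a / τ)
  have hZ : ∀ s, 1 ≤ Z s := fun s => by
    calc (1 : ℝ) = ∑ a, πstar s a * (adv s a / τ + 1) := by
          simp only [mul_add, mul_one, Finset.sum_add_distrib, hstar.2 s, ← mul_div_assoc,
            ← Finset.sum_div, hmean s, zero_div, zero_add]
      _ ≤ Z s := Finset.sum_le_sum fun a _ =>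
          mul_le_mul_of_nonneg_left (Real.add_one_le_exp _) (hstar.1 s a)
  have hZpos : ∀ s, 0 < Z s := fun s => one_pos.trans_le (hZ s)
  let π' : S → A → ℝ := fun s a => πstar s a * Real.exp (adv s a / τ) / Z s
  have hπ' : IsPolicy π' :=
    ⟨fun s a => div_nonneg (mul_nonneg (hstar.1 s a) (Real.exp_pos _).le) (hZpos s).le,
      fun s => by simp only [π', ← Finset.sum_div]; exact div_self (hZpos s).ne'⟩
  have hlog : ∀ s a, r s a + γ * ∑ s', P s a s' * V s' - V s - τ * Real.log (π' s a) =
      τ * Real.log (Z s) := fun s a => by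
    have h1 : Real.log (π' s a) = Real.log (πstar s a) + adv s a / τ - Real.log (Z s) := by
      simp only [π']
      rw [Real.log_div (mul_pos (hstarpos s a) (Real.exp_pos _)).ne' (hZpos s).ne',
        Real.log_mul (hstarpos s a).ne' (Real.exp_pos _).ne', Real.log_exp]
    rw [h1, mul_sub, mul_add, mul_div_cancel₀ _ hτ.ne', hadv]
    ring
  have hle : Vtau γ τ P πstar ρ r ≤ Vtau γ τ P π' ρ r := by
    rw [Vtau_eq_sum_occupancy hγ hP hstar hρ τ r V, Vtau_eq_sum_occupancy hγ hP hπ' hρ τ r V]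
    simp only [← hadv, hmean, hlog, mul_zero, Finset.sum_const_zero, ← Finset.sum_mul, hπ'.2,
      one_mul, add_zero]
    exact le_add_of_nonneg_right <| Finset.sum_nonneg fun s _ =>
      mul_nonneg (occupancy_nonneg hγ hP hπ' hρ s) (mul_nonneg hτ.le (Real.log_nonneg (hZ s)))
  have hfix : π' = πstar := huniq π' hπ' (le_antisymm (hopt π' hπ') hle)
  have hconst : ∀ a, adv s a = τ * Real.log (Z s) := fun a => by
    rw [← hlog s a, hfix, hadv]
  have hzero := hmean s
  simp only [hconst, ← Finset.sum_mul, hstar.2, one_mul] at hzero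
  rw [hconst, hzero]

end CMDP

/-- soft sub-optimality lemma: if `π*_τ` is the (unique, everywhere
positive) maximizer of the entropy-regularized value function over all policies, then for
every policy `π`,
`V_τ^{π*_τ}(ρ) − V_τ^π(ρ) = (τ/(1−γ))·Σ_s d_ρ^π(s)·D_KL(π(·|s) ‖ π*_τ(·|s))`. -/
theorem soft_suboptimality
    {S A : Type} [Fintype S] [Fintype A]
    (P : S → A → S → ℝ) (r : S → A → ℝ) (γ τ : ℝ) (ρ : S → ℝ)
    (hP : IsKernel P) (hr : ∀ s a, r s a ∈ Set.Icc (0 : ℝ) 1)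
    (hγ : γ ∈ Set.Ico (0 : ℝ) 1) (hρ : IsDist ρ) (hτ : 0 < τ)
    (πstar : S → A → ℝ) (hstar : IsPolicy πstar) (hstarpos : ∀ s a, 0 < πstar s a)
    (hopt : ∀ π : S → A → ℝ, IsPolicy π → Vtau γ τ P π ρ r ≤ Vtau γ τ P πstar ρ r)
    (huniq : ∀ π : S → A → ℝ, IsPolicy π →
      Vtau γ τ P π ρ r = Vtau γ τ P πstar ρ r → π = πstar)
    (π : S → A → ℝ) (hπ : IsPolicy π) :
    Vtau γ τ P πstar ρ r - Vtau γ τ P π ρ r =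
      (τ / (1 - γ)) * ∑ s, visit γ P π ρ s *
        ∑ a, π s a * (Real.log (π s a) - Real.log (πstar s a)) := by
  obtain ⟨V, hV⟩ := exists_bellman_solution hγ hP hstar
    fun s a => r s a - τ * Real.log (πstar s a)
  have hmean : ∀ s, ∑ a, πstar s a *
      (r s a + γ * ∑ s', P s a s' * V s' - V s - τ * Real.log (πstar s a)) = 0 := fun s => by
    have hVs : ∑ a, πstar s a * V s = V s := by rw [← Finset.sum_mul, hstar.2, one_mul]
    rw [← sub_eq_zero.2 ((hV s).trans hVs.symm), ← Finset.sum_sub_distrib]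
    exact Finset.sum_congr rfl fun a _ => by ring
  have hadv : ∀ s a, r s a + γ * ∑ s', P s a s' * V s' - V s = τ * Real.log (πstar s a) :=
    fun s a => sub_eq_zero.1 <| soft_advantage_eq_zero hP hγ hρ hτ hstar hstarpos hopt huniq
      (fun _ _ => rfl) hmean s a
  have hγ' : (1 - γ) ≠ 0 := (sub_pos.2 hγ.2).ne'
  have hvisit : ∀ s, visit γ P π ρ s = (1 - γ) * occupancy γ P π ρ s := fun _ => rfl
  rw [Vtau_eq_sum_occupancy hγ hP hstar hρ τ r V, Vtau_eq_sum_occupancy hγ hP hπ hρ τ r V]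
  simp only [hadv, hvisit, sub_self, mul_zero, Finset.sum_const_zero, add_zero,
    sub_add_cancel_left, mul_assoc, ← Finset.mul_sum]
  rw [← mul_assoc (τ / (1 - γ)), div_mul_cancel₀ _ hγ', ← Finset.sum_neg_distrib,
    Finset.mul_sum]
  refine Finset.sum_congr rfl fun s _ => ?_
  rw [← mul_neg, mul_left_comm, ← Finset.sum_neg_distrib, Finset.mul_sum _ _ τ]
  congr 1
  exact Finset.sum_congr rfl fun a _ => by ring
end
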